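/- Let B, T₁ > 0, let 𝒯_B be the set of trajectories ξ with sup_{t≥0} ‖ξ(t)‖_∞ ≤ B, equipped with the Borel σ-algebra induced by the supremum norm and a finite Borel measure μ, and let I = [0, T₁]. Define the STL kernel k'(φ, ψ) = ∫_{𝒯_B} ∫_I ρ(φ, ξ, t) ρ(ψ, ξ, t) dt dμ(ξ) on pairs of STL formulae. Then k' is a proper kernel: k'(φ, ψ) = k'(ψ, φ) for all STL formulae φ, ψ, and for every m ∈ ℕ, all STL formulae φ₁, …, φₘ and all c ∈ ℝᵐ, Σ_{i,j=1}^m cᵢ cⱼ k'(φᵢ, φⱼ) ≥ 0. -/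

import Mathlib

open scoped BoundedContinuousFunction

/-- Nonnegative time axis `[0,∞)`. -/
abbrev Time : Type := {t : ℝ // 0 ≤ t}

/-- A trajectory: a bounded continuous function `[0,∞) → ℝⁿ`
(`Fin n → ℝ` carries the sup norm). -/
abbrev Traj (n : ℕ) : Type := BoundedContinuousFunction Time (Fin n → ℝ)

/-- STL formulae: atomic predicates given by continuous functions `f_π : ℝⁿ → ℝ`
(asserting `f_π ≥ 0`), negation, conjunction, and until `U_[a,b]` with `0 ≤ a < b`. -/
inductive STLFormula (n : ℕ) : Type
  | atom : C((Fin n → ℝ), ℝ) → STLFormula n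
  | not : STLFormula n → STLFormula n
  | and : STLFormula n → STLFormula n → STLFormula n
  | until_ (a b : ℝ) (ha : 0 ≤ a) (hab : a < b) :
      STLFormula n → STLFormula n → STLFormula n

/-- Quantitative semantics (robustness) of STL. -/
noncomputable def robust {n : ℕ} (ξ : Traj n) : STLFormula n → Time → ℝ
  | .atom f, t => f (ξ t)
  | .not φ, t => - robust ξ φ t
  | .and φ ψ, t => min (robust ξ φ t) (robust ξ ψ t)
  | .until_ a b ha hab φ ψ, t =>
      sSup ((fun t' : Time =>
          min (robust ξ ψ t')
            (sInf ((fun t'' : Time => robust ξ φ t'') '' Set.Icc t t'))) ''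
        Set.Icc (⟨t.1 + a, add_nonneg t.2 ha⟩ : Time)
          (⟨t.1 + b, add_nonneg t.2 (ha.trans hab.le)⟩ : Time))

open MeasureTheory

/-- The set of trajectories bounded (in sup norm) by `B`, as a subspace of
`C_b([0,∞), ℝⁿ)`. -/
abbrev TrajB (n : ℕ) (B : ℝ) : Type := {ξ : Traj n // ∀ t : Time, ‖ξ t‖ ≤ B}

/-- `TrajB` carries its Borel σ-algebra (for the topology induced by the sup norm). -/
noncomputable instance {n : ℕ} {B : ℝ} : MeasurableSpace (TrajB n B) := borel _

instance {n : ℕ} {B : ℝ} : BorelSpace (TrajB n B) := ⟨rfl⟩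

/-- The time interval `I = [0, T₁]`. -/
abbrev TimeI (T₁ : ℝ) : Type := (Set.Icc (0:ℝ) T₁)

/-- Lebesgue measure on `I = [0, T₁]`, obtained from Lebesgue measure on `ℝ`. -/
noncomputable def lebI (T₁ : ℝ) : Measure (TimeI T₁) :=
  volume.comap Subtype.val

/-- The STL kernel `k'(φ, ψ) = ∫_{𝒯_B} ∫_I ρ(φ, ξ, t) ρ(ψ, ξ, t) dt dμ(ξ)`. -/
noncomputable def kSTL {n : ℕ} {B : ℝ} (μ : Measure (TrajB n B)) (T₁ : ℝ)
    (φ ψ : STLFormula n) : ℝ :=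
  ∫ ξ : TrajB n B,
    (∫ t : TimeI T₁,
      robust ξ.1 φ ⟨t.1, t.2.1⟩ * robust ξ.1 ψ ⟨t.1, t.2.1⟩ ∂(lebI T₁)) ∂μ

/-- Retraction of the real line onto the time axis. -/
noncomputable def toTime (x : ℝ) : Time := ⟨max x 0, le_max_right _ _⟩

lemma continuous_toTime : Continuous toTime := by
  unfold toTime; fun_prop

lemma toTime_coe (t : Time) : toTime t.1 = t := by
  apply Subtype.ext; exact max_eq_left t.2

lemma image_Icc_toTime (F : Time → ℝ) (x y : ℝ) (hx : 0 ≤ x) (hy : 0 ≤ y) :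
    F '' Set.Icc (⟨x, hx⟩ : Time) (⟨y, hy⟩ : Time) = (fun r : ℝ => F (toTime r)) '' Set.Icc x y := by
  ext z
  constructor
  · rintro ⟨s, ⟨h1, h2⟩, rfl⟩
    exact ⟨s.1, ⟨h1, h2⟩, by simp [toTime_coe]⟩
  · rintro ⟨r, ⟨h1, h2⟩, rfl⟩
    have : toTime r = ⟨r, hx.trans h1⟩ := toTime_coe ⟨r, hx.trans h1⟩
    exact ⟨⟨r, hx.trans h1⟩, ⟨h1, h2⟩, by simp [this]⟩

lemma image_Icc_unit (F : ℝ → ℝ) (x s : ℝ) (hs : 0 ≤ s) :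
    F '' Set.Icc x (x + s) = (fun u : ℝ => F (x + u * s)) '' Set.Icc (0:ℝ) 1 := by
  ext z
  constructor
  · rintro ⟨r, ⟨h1, h2⟩, rfl⟩
    rcases hs.eq_or_lt with h | h
    · refine ⟨0, ⟨le_rfl, zero_le_one⟩, ?_⟩
      have : r = x := by linarith
      simp [this]
    · refine ⟨(r - x) / s, ⟨by apply div_nonneg <;> linarith, ?_⟩, ?_⟩
      · rw [div_le_one h]; linarith
      · have : x + (r - x) / s * s = r := by field_simp; ring
        simp only [this]
  · rintro ⟨u, ⟨h1, h2⟩, rfl⟩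
    exact ⟨x + u * s, ⟨by nlinarith, by nlinarith⟩, rfl⟩

lemma image_Icc_shift (F : ℝ → ℝ) (x a b : ℝ) :
    F '' Set.Icc (x + a) (x + b) = (fun s : ℝ => F (x + s)) '' Set.Icc a b := by
  rw [← Set.image_const_add_Icc, Set.image_image]

lemma until_eq (f g : Time → ℝ) (a b : ℝ) (ha : 0 ≤ a) (hab : a < b) (t : Time) :
    sSup ((fun t' : Time =>
          min (g t') (sInf ((fun t'' : Time => f t'') '' Set.Icc t t'))) ''
        Set.Icc (⟨t.1 + a, add_nonneg t.2 ha⟩ : Time)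
          (⟨t.1 + b, add_nonneg t.2 (ha.trans hab.le)⟩ : Time)) =
    sSup ((fun s : ℝ => min (g (toTime (t.1 + s)))
      (sInf ((fun u : ℝ => f (toTime (t.1 + u * s))) '' Set.Icc (0:ℝ) 1))) '' Set.Icc a b) := by
  rw [image_Icc_toTime, image_Icc_shift]
  congr 1
  apply Set.image_congr
  intro s hs
  have hs0 : 0 ≤ s := ha.trans hs.1
  have h : toTime (t.1 + s) = ⟨t.1 + s, add_nonneg t.2 hs0⟩ :=
    toTime_coe ⟨t.1 + s, add_nonneg t.2 hs0⟩
  have h2 := image_Icc_toTime f t.1 (t.1 + s) t.2 (add_nonneg t.2 hs0)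
  rw [image_Icc_unit _ _ _ hs0] at h2
  rw [← h2, h]

lemma robust_until {n : ℕ} (ξ : Traj n) (a b : ℝ) (ha : 0 ≤ a) (hab : a < b)
    (φ ψ : STLFormula n) (t : Time) : robust ξ (.until_ a b ha hab φ ψ) t =
    sSup ((fun s : ℝ => min (robust ξ ψ (toTime (t.1 + s)))
      (sInf ((fun u : ℝ => robust ξ φ (toTime (t.1 + u * s))) '' Set.Icc (0:ℝ) 1))) ''
        Set.Icc a b) := by
  rw [robust]
  exact until_eq (robust ξ φ) (robust ξ ψ) a b ha hab t

lemma continuous_robust {n : ℕ} (φ : STLFormula n) :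
    Continuous (fun p : Traj n × Time => robust p.1 φ p.2) := by
  induction φ with
  | atom f =>
    simp only [robust]
    exact f.continuous.comp (by fun_prop)
  | not φ ih => simp only [robust]; exact ih.neg
  | and φ ψ ih1 ih2 => simp only [robust]; exact ih1.min ih2
  | until_ a b ha hab φ ψ ih1 ih2 =>
    simp only [robust_until]
    apply IsCompact.continuous_sSup (K := Set.Icc a b)
      (f := fun (p : Traj n × Time) (s : ℝ) => min (robust p.1 ψ (toTime (p.2.1 + s)))
      (sInf ((fun u : ℝ => robust p.1 φ (toTime (p.2.1 + u * s))) '' Set.Icc (0:ℝ) 1))) isCompact_Icc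
    refine Continuous.min ?_ ?_
    · exact ih2.comp (f := fun q : (Traj n × Time) × ℝ => (q.1.1, toTime (q.1.2.1 + q.2)))
        (by have := continuous_toTime; fun_prop)
    · apply IsCompact.continuous_sInf (K := Set.Icc (0:ℝ) 1)
        (f := fun (q : (Traj n × Time) × ℝ) (u : ℝ) =>
          robust q.1.1 φ (toTime (q.1.2.1 + u * q.2))) isCompact_Icc
      exact ih1.comp (f := fun r : ((Traj n × Time) × ℝ) × ℝ =>
        (r.1.1.1, toTime (r.1.1.2.1 + r.2 * r.1.2)))
        (by have := continuous_toTime; fun_prop)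

lemma abs_sSup_le_of {S : Set ℝ} (hS : S.Nonempty) {C : ℝ} (h : ∀ x ∈ S, |x| ≤ C) :
    |sSup S| ≤ C := by
  obtain ⟨x, hx⟩ := hS
  rw [abs_le]
  refine ⟨(abs_le.1 (h x hx)).1.trans (le_csSup ⟨C, fun y hy => (abs_le.1 (h y hy)).2⟩ hx), ?_⟩
  exact csSup_le ⟨x, hx⟩ fun y hy => (abs_le.1 (h y hy)).2

lemma abs_sInf_le_of {S : Set ℝ} (hS : S.Nonempty) {C : ℝ} (h : ∀ x ∈ S, |x| ≤ C) :
    |sInf S| ≤ C := by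
  obtain ⟨x, hx⟩ := hS
  rw [abs_le]
  refine ⟨le_csInf ⟨x, hx⟩ fun y hy => (abs_le.1 (h y hy)).1, ?_⟩
  exact (csInf_le ⟨-C, fun y hy => (abs_le.1 (h y hy)).1⟩ hx).trans (abs_le.1 (h x hx)).2

lemma abs_min_le_of {x y C D : ℝ} (hx : |x| ≤ C) (hy : |y| ≤ D) : |min x y| ≤ max C D :=
  abs_min_le_max_abs_abs.trans (max_le_max hx hy)

lemma robust_bounded {n : ℕ} (B : ℝ) (φ : STLFormula n) :
    ∃ C, ∀ (ξ : TrajB n B) (t : Time), |robust ξ.1 φ t| ≤ C := by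
  induction φ with
  | atom f =>
    obtain ⟨C, hC⟩ := (isCompact_closedBall (0 : Fin n → ℝ) B).exists_bound_of_continuousOn
      f.continuous.continuousOn
    exact ⟨C, fun ξ t => hC _ (by simpa using ξ.2 t)⟩
  | not φ ih => simpa only [robust, abs_neg] using ih
  | and φ ψ ih1 ih2 =>
    obtain ⟨C, hC⟩ := ih1
    obtain ⟨D, hD⟩ := ih2
    exact ⟨max C D, fun ξ t => abs_min_le_of (hC ξ t) (hD ξ t)⟩
  | until_ a b ha hab φ ψ ih1 ih2 =>
    obtain ⟨C, hC⟩ := ih1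
    obtain ⟨D, hD⟩ := ih2
    refine ⟨max D C, fun ξ t => ?_⟩
    simp only [robust_until]
    apply abs_sSup_le_of ((Set.nonempty_Icc.2 hab.le).image _)
    rintro _ ⟨s, hs, rfl⟩
    refine abs_min_le_of (hD _ _) (abs_sInf_le_of ((Set.nonempty_Icc.2 zero_le_one).image _) ?_)
    rintro _ ⟨u, hu, rfl⟩
    exact hC _ _

instance isFinite_lebI (T₁ : ℝ) : IsFiniteMeasure (lebI T₁) := by
  refine ⟨?_⟩
  rw [lebI, Measure.comap_apply _ Subtype.val_injective
    (fun s hs => (MeasurableEmbedding.subtype_coe measurableSet_Icc).measurableSet_image.2 hs)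
    _ MeasurableSet.univ, Set.image_univ, Subtype.range_coe, Real.volume_Icc]
  exact ENNReal.ofReal_lt_top

section integr
variable {n : ℕ} {B : ℝ} (μ : Measure (TrajB n B)) [IsFiniteMeasure μ] (T₁ : ℝ)
  (φ ψ : STLFormula n)

lemma continuous_prod_robust : Continuous (fun p : TrajB n B × TimeI T₁ =>
    robust p.1.1 φ ⟨p.2.1, p.2.2.1⟩ * robust p.1.1 ψ ⟨p.2.1, p.2.2.1⟩) := by
  have h : Continuous (fun p : TrajB n B × TimeI T₁ =>
      ((p.1.1, ⟨p.2.1, p.2.2.1⟩) : Traj n × Time)) := by fun_prop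
  exact ((continuous_robust φ).comp h).mul ((continuous_robust ψ).comp h)

lemma prod_bounded : ∃ C, ∀ (ξ : TrajB n B) (t : TimeI T₁),
    ‖robust ξ.1 φ ⟨t.1, t.2.1⟩ * robust ξ.1 ψ ⟨t.1, t.2.1⟩‖ ≤ C := by
  obtain ⟨C, hC⟩ := robust_bounded B φ
  obtain ⟨D, hD⟩ := robust_bounded B ψ
  refine ⟨C * D, fun ξ t => ?_⟩
  rw [norm_mul]
  exact mul_le_mul (hC _ _) (hD _ _) (norm_nonneg _) ((abs_nonneg _).trans (hC ξ ⟨t.1, t.2.1⟩))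

lemma integrable_inner (ξ : TrajB n B) : Integrable (fun t : TimeI T₁ =>
    robust ξ.1 φ ⟨t.1, t.2.1⟩ * robust ξ.1 ψ ⟨t.1, t.2.1⟩) (lebI T₁) := by
  obtain ⟨C, hC⟩ := prod_bounded (B := B) T₁ φ ψ
  refine Integrable.of_bound (Continuous.aestronglyMeasurable ?_) C (.of_forall (hC ξ))
  exact (continuous_prod_robust T₁ φ ψ).comp (Continuous.prodMk_right ξ)

lemma integrable_outer : Integrable (fun ξ : TrajB n B => ∫ t : TimeI T₁,
    robust ξ.1 φ ⟨t.1, t.2.1⟩ * robust ξ.1 ψ ⟨t.1, t.2.1⟩ ∂(lebI T₁)) μ := by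
  obtain ⟨C, hC⟩ := prod_bounded (B := B) T₁ φ ψ
  refine Integrable.of_bound (Continuous.aestronglyMeasurable ?_) (C * (lebI T₁).real Set.univ)
    (.of_forall fun ξ => norm_integral_le_of_norm_le_const (.of_forall (hC ξ)))
  refine continuous_of_dominated (bound := fun _ => C)
    (fun ξ => (integrable_inner T₁ φ ψ ξ).aestronglyMeasurable)
    (fun ξ => .of_forall (hC ξ)) (integrable_const _) (.of_forall fun t => ?_)
  exact (continuous_prod_robust T₁ φ ψ).comp (Continuous.prodMk_left t)

end integr

/-- the STL kernel `k'` is a proper kernel: it is symmetric, and for all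
formulae `φ₁, …, φₘ` and coefficients `c ∈ ℝᵐ`, `∑ i j, cᵢ cⱼ k'(φᵢ, φⱼ) ≥ 0`. -/
theorem kSTL_proper_kernel {n : ℕ} (B T₁ : ℝ) (hB : 0 < B) (hT : 0 < T₁)
    (μ : Measure (TrajB n B)) [IsFiniteMeasure μ] :
    (∀ φ ψ : STLFormula n, kSTL μ T₁ φ ψ = kSTL μ T₁ ψ φ) ∧
      (∀ (m : ℕ) (φs : Fin m → STLFormula n) (c : Fin m → ℝ),
        0 ≤ ∑ i, ∑ j, c i * c j * kSTL μ T₁ (φs i) (φs j)) := by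
  refine ⟨fun φ ψ => ?_, fun m φs c => ?_⟩
  · simp only [kSTL, mul_comm]
  · have key : ∑ i, ∑ j, c i * c j * kSTL μ T₁ (φs i) (φs j) =
        ∫ ξ : TrajB n B, (∫ t : TimeI T₁,
          (∑ i, c i * robust ξ.1 (φs i) ⟨t.1, t.2.1⟩) ^ 2 ∂(lebI T₁)) ∂μ := by
      have h1 : ∀ ξ : TrajB n B, (∫ t : TimeI T₁,
          (∑ i, c i * robust ξ.1 (φs i) ⟨t.1, t.2.1⟩) ^ 2 ∂(lebI T₁)) =
          ∑ i, ∑ j, c i * c j * ∫ t : TimeI T₁, robust ξ.1 (φs i) ⟨t.1, t.2.1⟩ *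
            robust ξ.1 (φs j) ⟨t.1, t.2.1⟩ ∂(lebI T₁) := by
        intro ξ
        simp_rw [← integral_const_mul]
        have h2 : ∀ i j, Integrable (fun t : TimeI T₁ => c i * c j *
            (robust ξ.1 (φs i) ⟨t.1, t.2.1⟩ * robust ξ.1 (φs j) ⟨t.1, t.2.1⟩)) (lebI T₁) :=
          fun i j => (integrable_inner T₁ (φs i) (φs j) ξ).const_mul _
        simp_rw [← integral_finsetSum _ (fun j _ => h2 _ j)]
        rw [← integral_finsetSum _ (fun i _ => integrable_finsetSum _ (fun j _ => h2 i j))]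
        congr 1
        ext t
        rw [sq, Finset.sum_mul_sum]
        exact Finset.sum_congr rfl fun i _ => Finset.sum_congr rfl fun j _ => by ring
      simp_rw [h1]
      have h3 := fun i j => (integrable_outer μ T₁ (φs i) (φs j)).const_mul (c i * c j)
      rw [integral_finsetSum _ (fun i _ => integrable_finsetSum _ (fun j _ => h3 i j))]
      refine Finset.sum_congr rfl fun i _ => ?_
      rw [integral_finsetSum _ (fun j _ => h3 i j)]
      refine Finset.sum_congr rfl fun j _ => ?_
      rw [integral_const_mul, kSTL]
    rw [key]
    exact integral_nonneg fun ξ => integral_nonneg fun t => sq_nonneg _
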